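/- Let A be a positive integer. If (A, A) is a polynomial pair, then (A*, A*) is also a polynomial pair, and moreover (A²)* = (A*)², where N* denotes the base-10 reversal of N. -/

import Mathlib

/-- The `i`-th base-10 digit of `N` (0 if out of range). -/
def digit (N i : ℕ) : ℕ := (Nat.digits 10 N).getD i 0

/-- The polynomial whose coefficient of `X ^ i` is the `i`-th base-10 digit of `N`. -/
noncomputable def digitPoly (N : ℕ) : Polynomial ℕ :=
  ∑ i ∈ Finset.range (Nat.digits 10 N).length, Polynomial.C (digit N i) * Polynomial.X ^ i

/-- The base-10 reversal of `N`. -/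
def rev (N : ℕ) : ℕ := Nat.ofDigits 10 (Nat.digits 10 N).reverse

/-- The multiplication of `A` by `B` can be performed without carry in base 10:
every convolution sum of digits is at most 9. -/
def NoCarryMul (A B : ℕ) : Prop :=
  ∀ k, ∑ i ∈ Finset.range (k + 1), digit A i * digit B (k - i) ≤ 9

/-- The maximum base-10 digit of `N`. -/
def maxDigit (N : ℕ) : ℕ := (Nat.digits 10 N).foldr max 0

/-- The sum of the base-10 digits of `N`. -/
def digitSum (N : ℕ) : ℕ := (Nat.digits 10 N).sum

/-- The `i`-th base-`b` digit of `N` (0 if out of range). -/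
def digitB (b N i : ℕ) : ℕ := (Nat.digits b N).getD i 0

/-- The base-`b` reversal of `N`. -/
def revB (b N : ℕ) : ℕ := Nat.ofDigits b (Nat.digits b N).reverse

/-- The multiplication of `A` by `B` can be performed without carry in base `b`:
every convolution sum of base-`b` digits is at most `b - 1`. -/
def NoCarryMulB (b A B : ℕ) : Prop :=
  ∀ k, ∑ i ∈ Finset.range (k + 1), digitB b A i * digitB b B (k - i) ≤ b - 1

open Polynomial in
/-- If all coefficients of `P` are decimal digits, they are the digits of `P.eval 10`. -/
lemma digit_eval_ten (P : ℕ[X]) (hP : ∀ i, P.coeff i ≤ 9) (i : ℕ) :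
    digit (P.eval 10) i = P.coeff i := by
  unfold digit
  rw [Nat.getD_digits _ _ (by norm_num)]
  induction i generalizing P with
  | zero =>
    have h := congrArg (eval 10) P.divX_mul_X_add
    simp only [eval_add, eval_mul, eval_X, eval_C] at h
    have := hP 0
    rw [pow_zero, Nat.div_one]
    omega
  | succ i ih =>
    have h := congrArg (eval 10) P.divX_mul_X_add
    simp only [eval_add, eval_mul, eval_X, eval_C] at h
    have h0 := hP 0
    have hdiv : P.eval 10 / 10 = P.divX.eval 10 := by omega
    rw [pow_succ', ← Nat.div_div_eq_div_mul, hdiv, ih _ fun j => by simpa using hP (j + 1),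
      coeff_divX]

lemma ofDigits_map_range (b : ℕ) (f : ℕ → ℕ) (n : ℕ) :
    Nat.ofDigits b ((List.range n).map f) = ∑ i ∈ Finset.range n, f i * b ^ i := by
  induction n with
  | zero => simp
  | succ n ih =>
    rw [List.range_succ, List.map_append, Nat.ofDigits_append, ih, Finset.sum_range_succ]
    simp [mul_comm]

lemma reverse_map_range (f : ℕ → ℕ) (n : ℕ) :
    ((List.range (n + 1)).map f).reverse = (List.range (n + 1)).map fun i => f (n - i) := by
  apply List.ext_getElem <;> simp

open Polynomial in
/-- Reversing decimal digits corresponds to reversing the digit polynomial. -/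
lemma rev_eval_ten (P : ℕ[X]) (hP : ∀ i, P.coeff i ≤ 9) :
    rev (P.eval 10) = P.reverse.eval 10 := by
  rcases eq_or_ne P 0 with rfl | hne
  · simp [rev]
  have hdigits : Nat.digits 10 (P.eval 10) = (List.range (P.natDegree + 1)).map P.coeff := by
    rw [eval_eq_sum_range, ← ofDigits_map_range]
    apply Nat.digits_ofDigits 10 (by norm_num)
    · intro l hl
      obtain ⟨i, -, rfl⟩ := List.mem_map.1 hl
      have := hP i
      omega
    · intro _
      simpa [List.range_succ] using hne
  rw [rev, hdigits, reverse_map_range, ofDigits_map_range,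
    eval_eq_sum_range' (Nat.lt_succ_of_le P.reverse_natDegree_le)]
  refine Finset.sum_congr rfl fun i hi => ?_
  rw [coeff_reverse, revAt_le (Nat.lt_succ_iff.1 (Finset.mem_range.1 hi))]

lemma digit_le_nine (N i : ℕ) : digit N i ≤ 9 := by
  unfold digit
  rw [Nat.getD_digits _ _ (by norm_num)]
  omega

lemma coeff_digitPoly (N i : ℕ) : (digitPoly N).coeff i = digit N i := by
  simp only [digitPoly, Polynomial.finsetSum_coeff, Polynomial.coeff_C_mul_X_pow]
  rw [Finset.sum_ite_eq]
  split_ifs with h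
  · rfl
  · simp only [Finset.mem_range, not_lt] at h
    exact (List.getD_eq_default _ _ h).symm

lemma eval_digitPoly (N : ℕ) : (digitPoly N).eval 10 = N := by
  rw [digitPoly, Polynomial.eval_finsetSum]
  simp only [Polynomial.eval_mul, Polynomial.eval_C, Polynomial.eval_pow, Polynomial.eval_X]
  rw [← ofDigits_map_range]
  conv_rhs => rw [← Nat.ofDigits_digits 10 N]
  congr 1
  apply List.ext_getElem
  · simp
  · intro i h₁ h₂
    simp [digit, h₂]

open Polynomial in
lemma noCarryMul_eval_ten (P Q : ℕ[X]) (hP : ∀ i, P.coeff i ≤ 9) (hQ : ∀ i, Q.coeff i ≤ 9) :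
    NoCarryMul (P.eval 10) (Q.eval 10) ↔ ∀ k, (P * Q).coeff k ≤ 9 := by
  simp only [NoCarryMul, digit_eval_ten P hP, digit_eval_ten Q hQ, coeff_mul]
  simp only [Finset.Nat.sum_antidiagonal_eq_sum_range_succ fun i j => P.coeff i * Q.coeff j]

/-- if `(A, A)` is a polynomial pair, then so is `(A*, A*)`, and
`(A²)* = (A*)²`. -/
theorem stmt17 (A : ℕ) (hA : 0 < A) (h : NoCarryMul A A) :
    NoCarryMul (rev A) (rev A) ∧ rev (A ^ 2) = (rev A) ^ 2 := by
  obtain ⟨P, hP, rfl⟩ : ∃ P : Polynomial ℕ, (∀ i, P.coeff i ≤ 9) ∧ P.eval 10 = A :=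
    ⟨digitPoly A, fun i => coeff_digitPoly A i ▸ digit_le_nine A i, eval_digitPoly A⟩
  have hsq := (noCarryMul_eval_ten P P hP hP).1 h
  have hrev (Q : Polynomial ℕ) (hQ : ∀ i, Q.coeff i ≤ 9) (i : ℕ) : Q.reverse.coeff i ≤ 9 := by
    rw [Polynomial.coeff_reverse]
    exact hQ _
  rw [rev_eval_ten P hP]
  constructor
  · rw [noCarryMul_eval_ten _ _ (hrev P hP) (hrev P hP), ← Polynomial.reverse_mul_of_domain]
    exact hrev _ hsq
  · rw [sq, ← Polynomial.eval_mul, rev_eval_ten _ hsq, Polynomial.reverse_mul_of_domain,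
      Polynomial.eval_mul, sq]
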